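/- Let M be a C² compact d-dimensional submanifold of ℝ^D without boundary with reach τ > 0 and let 0 < σ < τ. Let U_{M_σ} be the uniform (normalized Lebesgue) distribution on the tube M_σ, let U_M be the uniform distribution on M (normalized d-dimensional volume measure), and let Ũ_{M_σ} be the pushforward of U_{M_σ} under the nearest-point projection Proj_M : M_σ → M. Then Ũ_{M_σ} and U_M are mutually absolutely continuous, and ((τ−σ)/(τ+σ))^d ≤ dŨ_{M_σ}/dU_M ≤ ((τ+σ)/(τ−σ))^d almost everywhere. -/

import Mathlib

open MeasureTheory ProbabilityTheory Metric
open scoped ENNReal RealInnerProductSpace BigOperators Classical Matrix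

noncomputable section

abbrev Euc (D : ℕ) := EuclideanSpace ℝ (Fin D)

/-- The open tube of radius `r` around a set `M ⊆ ℝ^D`. -/
def tube {D : ℕ} (M : Set (Euc D)) (r : ℝ) : Set (Euc D) := {y | Metric.infDist y M < r}

/-- The reach of a set `M ⊆ ℝ^D`: the supremum of all `r ≥ 0` such that every point of the
open `r`-tube around `M` has a unique nearest point in `M`. -/
def reach {D : ℕ} (M : Set (Euc D)) : ℝ :=
  sSup {r : ℝ | 0 ≤ r ∧ ∀ y ∈ tube M r, ∃! x, x ∈ M ∧ dist y x = Metric.infDist y M}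

/-- A compact `C²` `d`-dimensional embedded submanifold of `ℝ^D` without boundary, encoded by
the property of being locally the graph of a `C²` map over its tangent space, starting with
zero value and zero derivative at the base point. `tangentAt y` is the tangent space at `y`
(translated to the origin, i.e. viewed as a linear subspace of `ℝ^D`). -/
structure C2CompactSubmanifold (D d : ℕ) where
  carrier : Set (Euc D)
  nonempty : carrier.Nonempty
  isCompact : IsCompact carrier
  tangentAt : Euc D → Submodule ℝ (Euc D)
  finrank_tangent : ∀ y ∈ carrier, Module.finrank ℝ (tangentAt y) = d
  locally_graph : ∀ y ∈ carrier, ∃ ε > 0,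
    ∃ f : tangentAt y → ((tangentAt y)ᗮ : Submodule ℝ (Euc D)),
      ContDiff ℝ 2 f ∧ f 0 = 0 ∧ fderiv ℝ f 0 = 0 ∧
        carrier ∩ ball y ε =
          (Set.range fun v : tangentAt y => y + (v : Euc D) + (f v : Euc D)) ∩ ball y ε

/-- Uniform (normalized Lebesgue) distribution on a subset of `ℝ^D`. -/
def unifOn {D : ℕ} (A : Set (Euc D)) : Measure (Euc D) :=
  (volume A)⁻¹ • volume.restrict A

/-- Uniform distribution on a `d`-dimensional submanifold `M ⊆ ℝ^D`, i.e. normalized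
`d`-dimensional Hausdorff (volume) measure on `M`. -/
def uniformOnManifold {D : ℕ} (d : ℕ) (M : Set (Euc D)) : Measure (Euc D) :=
  (μH[(d : ℝ)] M)⁻¹ • (μH[(d : ℝ)] : Measure (Euc D)).restrict M

/-! ### Part A: reach -/

/-- `M` has unique nearest points within distance `τ`. -/
def UniqNear {D : ℕ} (M : Set (Euc D)) (τ : ℝ) : Prop :=
  ∀ z, Metric.infDist z M < τ → ∃! x, x ∈ M ∧ dist z x = Metric.infDist z M

lemma uniqNear_reach {D : ℕ} (M : Set (Euc D)) : UniqNear M (reach M) := by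
  intro z hz
  have hne : {r : ℝ | 0 ≤ r ∧ ∀ y ∈ tube M r, ∃! x, x ∈ M ∧ dist y x = Metric.infDist y M}.Nonempty := by
    refine ⟨0, le_refl _, ?_⟩
    intro y hy
    exact absurd hy (not_lt.mpr Metric.infDist_nonneg)
  obtain ⟨r, hr, hzr⟩ := exists_lt_of_lt_csSup hne hz
  exact hr.2 z hzr

lemma near_limit {D : ℕ} {M : Set (Euc D)} (hM : IsCompact M) {τ : ℝ} (hu : UniqNear M τ)
    {w p : Euc D} (hw : Metric.infDist w M < τ) (hp : p ∈ M) (hpd : dist w p = Metric.infDist w M)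
    {ws ps : ℕ → Euc D} (hws : Filter.Tendsto ws Filter.atTop (nhds w))
    (hps : ∀ n, ps n ∈ M) (hpsd : ∀ n, dist (ws n) (ps n) = Metric.infDist (ws n) M) :
    ∃ φ : ℕ → ℕ, StrictMono φ ∧ Filter.Tendsto (ps ∘ φ) Filter.atTop (nhds p) := by
  obtain ⟨q, hq, φ, hφ, hlim⟩ := hM.tendsto_subseq hps
  refine ⟨φ, hφ, ?_⟩
  have h1 : Filter.Tendsto (fun n => dist (ws (φ n)) (ps (φ n))) Filter.atTop (nhds (dist w q)) :=
    (hws.comp hφ.tendsto_atTop).dist hlim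
  have h2 : Filter.Tendsto (fun n => Metric.infDist (ws (φ n)) M) Filter.atTop
      (nhds (Metric.infDist w M)) :=
    ((Metric.continuous_infDist_pt M).tendsto w).comp (hws.comp hφ.tendsto_atTop)
  have h3 : dist w q = Metric.infDist w M := by
    refine tendsto_nhds_unique h1 ?_
    simpa only [hpsd] using h2
  have : q = p := (hu w hw).unique ⟨hq, h3⟩ ⟨hp, hpd⟩
  rwa [this] at hlim

lemma reach_step {D : ℕ} {M : Set (Euc D)} (hM : IsCompact M) (hne : M.Nonempty) {τ : ℝ}
    (hu : UniqNear M τ) {x v : Euc D} (hx : x ∈ M) (hv : ‖v‖ = 1) {t h : ℝ} (ht : 0 < t)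
    (h0 : 0 < h) (hht : h ≤ t) (hτ : t + h < τ) (hd : Metric.infDist (x + t • v) M = t) :
    Metric.infDist (x + (t + h) • v) M = t + h := by
  set z := x + t • v with hz
  obtain ⟨w, hwb, hwmax⟩ := (isCompact_closedBall z h).exists_isMaxOn
    ⟨z, Metric.mem_closedBall_self h0.le⟩ (Metric.continuous_infDist_pt M).continuousOn
  have hwz : dist w z ≤ h := hwb
  have hwmax' : ∀ q, dist q z ≤ h → Metric.infDist q M ≤ Metric.infDist w M := fun q hq =>
    hwmax (Metric.mem_closedBall.2 hq)
  have hwt : t ≤ Metric.infDist w M := by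
    rw [← hd]; exact hwmax' z (by simpa using h0.le)
  have hwτ : Metric.infDist w M < τ := by
    have := Metric.infDist_le_infDist_add_dist (x := w) (y := z) (s := M)
    linarith
  obtain ⟨p, hp, hpd⟩ := hM.exists_infDist_eq_dist hne w
  have hpd' : dist w p = Metric.infDist w M := hpd.symm
  have key : ∀ q, dist q z ≤ h → ⟪q - w, w - p⟫ ≤ 0 := by
    intro q hq
    let s : ℕ → ℝ := fun n => 1 / ((n : ℝ) + 1)
    have hs0 : ∀ n, 0 < s n := fun n => by positivity
    have hs1 : ∀ n, s n ≤ 1 := fun n => by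
      change 1 / ((n : ℝ) + 1) ≤ 1; rw [div_le_one (by positivity)]; linarith [(Nat.cast_nonneg n : (0:ℝ) ≤ n)]
    have hslim : Filter.Tendsto s Filter.atTop (nhds 0) := tendsto_one_div_add_atTop_nhds_zero_nat
    let ws : ℕ → Euc D := fun n => w + s n • (q - w)
    have hwslim : Filter.Tendsto ws Filter.atTop (nhds w) := by
      have := (hslim.smul_const (q - w)).const_add w
      simpa using this
    have hex : ∀ n, ∃ p' ∈ M, Metric.infDist (ws n) M = dist (ws n) p' := fun n =>
      hM.exists_infDist_eq_dist hne (ws n)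
    choose ps hps hpsd using hex
    have hwsball : ∀ n, dist (ws n) z ≤ h := by
      intro n
      have hc := convex_closedBall z h
      have := hc.add_smul_sub_mem hwb (Metric.mem_closedBall.2 hq) ⟨(hs0 n).le, hs1 n⟩
      exact this
    have hineq : ∀ n, ⟪q - w, (2:ℝ) • (w - ps n) + s n • (q - w)⟫ ≤ 0 := by
      intro n
      have h1 : dist (ws n) (ps n) ≤ dist w (ps n) := by
        rw [← hpsd n]
        exact (hwmax' _ (hwsball n)).trans (Metric.infDist_le_dist_of_mem (hps n))
      have h2 : ‖(w - ps n) + s n • (q - w)‖ ≤ ‖w - ps n‖ := by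
        rw [dist_eq_norm, dist_eq_norm] at h1
        have e : (w - ps n) + s n • (q - w) = ws n - ps n := by
          change _ = w + s n • (q - w) - ps n; abel
        rw [e]; exact h1
      have h3 : ‖(w - ps n) + s n • (q - w)‖ ^ 2 ≤ ‖w - ps n‖ ^ 2 := by gcongr
      rw [norm_add_sq_real, norm_smul, mul_pow, inner_smul_right] at h3
      rw [inner_add_right, inner_smul_right, inner_smul_right, real_inner_self_eq_norm_sq]
      rw [real_inner_comm] at h3
      have h4 : s n * (2 * ⟪q - w, w - ps n⟫ + s n * ‖q - w‖ ^ 2) ≤ 0 := by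
        have : ‖s n‖ ^ 2 = s n ^ 2 := by simp
        rw [this] at h3
        nlinarith
      by_contra hcon
      push Not at hcon
      exact absurd h4 (not_le.2 (mul_pos (hs0 n) hcon))
    obtain ⟨φ, hφ, hlim⟩ := near_limit hM hu hwτ hp hpd' hwslim hps (fun n => (hpsd n).symm)
    have hlim2 : Filter.Tendsto (fun n => ⟪q - w, (2:ℝ) • (w - ps (φ n)) + s (φ n) • (q - w)⟫)
        Filter.atTop (nhds ⟪q - w, (2:ℝ) • (w - p) + (0:ℝ) • (q - w)⟫) := by
      refine Filter.Tendsto.inner tendsto_const_nhds ?_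
      refine Filter.Tendsto.add ((hlim.const_sub w).const_smul 2) ?_
      exact (hslim.comp hφ.tendsto_atTop).smul_const _
    have := le_of_tendsto' hlim2 (fun n => hineq (φ n))
    rw [zero_smul, add_zero, inner_smul_right] at this
    linarith
  set δ := Metric.infDist w M with hδ
  have hδ0 : 0 < δ := lt_of_lt_of_le ht hwt
  have hnp : ‖w - p‖ = δ := by rw [← dist_eq_norm, hpd']
  -- the unit direction
  set n := δ⁻¹ • (w - p) with hn
  have hn1 : ‖n‖ = 1 := by
    rw [hn, norm_smul, hnp, norm_inv, Real.norm_of_nonneg hδ0.le, inv_mul_cancel₀ hδ0.ne']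
  have hwp : w - p = δ • n := by rw [hn, smul_smul, mul_inv_cancel₀ hδ0.ne', one_smul]
  have hk := key (z + h • n) (by rw [dist_eq_norm]; simp [norm_smul, hn1, abs_of_pos h0])
  have hk2 : h ≤ ⟪w - z, n⟫ := by
    rw [hwp, inner_smul_right] at hk
    have h5 : ⟪z + h • n - w, n⟫ ≤ 0 := by
      by_contra hcon
      push Not at hcon
      exact absurd hk (not_le.2 (mul_pos hδ0 hcon))
    have h6 : z + h • n - w = h • n - (w - z) := by abel
    rw [h6, inner_sub_left, inner_smul_left, real_inner_self_eq_norm_sq, hn1] at h5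
    simp at h5
    linarith
  have hwzn : w - z = h • n := by
    have : ‖w - z - h • n‖ ^ 2 ≤ 0 := by
      rw [norm_sub_sq_real, inner_smul_right, norm_smul, hn1]
      have h7 : ‖w - z‖ ≤ h := by rw [← dist_eq_norm]; exact hwz
      have h8 : ‖w - z‖ ^ 2 ≤ h ^ 2 := by gcongr
      have : (‖h‖ * 1) ^ 2 = h ^ 2 := by simp
      rw [this]
      nlinarith
    have h9 : ‖w - z - h • n‖ = 0 := by
      have := sq_nonneg ‖w - z - h • n‖
      exact pow_eq_zero_iff (two_ne_zero) |>.1 (le_antisymm ‹_› this)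
    exact sub_eq_zero.1 (norm_eq_zero.1 h9)
  -- z lies on the segment [p, w]
  have hzp : z - p = (δ - h) • n := by
    have : z - p = (w - p) - (w - z) := by abel
    rw [this, hwp, hwzn, sub_smul]
  have hzpd : dist z p = δ - h := by
    rw [dist_eq_norm, hzp, norm_smul, hn1, mul_one, Real.norm_of_nonneg (by linarith)]
  have hδle : δ ≤ t + h := by
    have := Metric.infDist_le_infDist_add_dist (x := w) (y := z) (s := M)
    linarith
  have hzinf : Metric.infDist z M = δ - h := by
    apply le_antisymm
    · rw [← hzpd]; exact Metric.infDist_le_dist_of_mem hp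
    · rw [hd]; linarith
  have hxz : dist z x = t := by
    rw [dist_eq_norm, hz]; simp [norm_smul, hv, abs_of_pos ht]
  have hpx : p = x := (hu z (by linarith)).unique ⟨hp, by rw [hzpd, hzinf]⟩ ⟨hx, by rw [hxz, hd]⟩
  have hδt : δ = t + h := by linarith
  have hnv : n = v := by
    have h10 : t • v = t • n := by
      have : t • v = z - p := by rw [hz, hpx]; abel
      rw [this, hzp]; congr 1; linarith
    exact (smul_right_injective _ ht.ne' h10).symm
  have : x + (t + h) • v = w := by
    have : w = (w - z) + z := by abel
    rw [this, hwzn, hnv, hz, add_smul]; abel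
  rw [this, ← hδ, hδt]

lemma infDist_shrink {D : ℕ} {M : Set (Euc D)} {x ν : Euc D} (hx : x ∈ M) {t s : ℝ}
    (hs0 : 0 ≤ s) (hst : s ≤ t)
    (hd : Metric.infDist (x + t • ν) M = t * ‖ν‖) : Metric.infDist (x + s • ν) M = s * ‖ν‖ := by
  apply le_antisymm
  · refine (Metric.infDist_le_dist_of_mem hx).trans ?_
    rw [dist_eq_norm]; simp [norm_smul, abs_of_nonneg hs0]
  · have := Metric.infDist_le_infDist_add_dist (x := x + t • ν) (y := x + s • ν) (s := M)
    rw [hd, dist_eq_norm] at this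
    have h2 : x + t • ν - (x + s • ν) = (t - s) • ν := by rw [sub_smul]; abel
    rw [h2, norm_smul, Real.norm_of_nonneg (by linarith)] at this
    linarith

lemma reach_extend {D : ℕ} {M : Set (Euc D)} (hM : IsCompact M) (hne : M.Nonempty) {τ : ℝ}
    (hu : UniqNear M τ) {x ν : Euc D} (hx : x ∈ M) (hντ : ‖ν‖ < τ) {t₀ : ℝ} (ht₀ : 0 < t₀)
    (hd : Metric.infDist (x + t₀ • ν) M = t₀ * ‖ν‖) :
    Metric.infDist (x + ν) M = ‖ν‖ := by
  rcases eq_or_ne ν 0 with rfl | hν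
  · simp [Metric.infDist_zero_of_mem hx]
  have hνp : 0 < ‖ν‖ := norm_pos_iff.2 hν
  set v := ‖ν‖⁻¹ • ν with hvdef
  have hv : ‖v‖ = 1 := by simp [hvdef, norm_smul, hνp.ne']
  have hνv : ν = ‖ν‖ • v := by rw [hvdef, smul_smul, mul_inv_cancel₀ hνp.ne', one_smul]
  set a := t₀ * ‖ν‖ with ha
  have ha0 : 0 < a := by positivity
  have hda : Metric.infDist (x + a • v) M = a := by
    have : a • v = t₀ • ν := by
      conv_rhs => rw [hνv, smul_smul]
    rw [this, hd]
  have ind : ∀ n : ℕ, ∀ s, 0 < s → s ≤ 2 ^ n * a → s < τ → Metric.infDist (x + s • v) M = s := by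
    intro n
    induction n with
    | zero =>
      intro s hs0 hs _
      have := infDist_shrink (ν := v) hx (t := a) (s := s) hs0.le (by simpa using hs)
        (by rw [hda, hv, mul_one])
      rw [this, hv, mul_one]
    | succ n ih =>
      intro s hs0 hs hsτ
      have h1 := ih (s / 2) (by linarith) (by rw [pow_succ] at hs; linarith) (by linarith)
      have := reach_step hM hne hu hx hv (t := s / 2) (h := s / 2) (by linarith) (by linarith)
        le_rfl (by linarith) h1
      simpa using this
  obtain ⟨n, hn⟩ := pow_unbounded_of_one_lt (‖ν‖ / a) (one_lt_two : (1:ℝ) < 2)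
  have := ind n ‖ν‖ hνp (by rw [div_lt_iff₀ ha0] at hn; exact hn.le) hντ
  rwa [← hνv] at this

/-! ### Part B: local graph charts in coordinates -/

/-- A local graph chart of `M` at `y`, in Euclidean coordinates. -/
structure GChart {D : ℕ} (d k : ℕ) (M : Set (Euc D)) (y : Euc D) where
  J : WithLp 2 (Euc d × Euc k) ≃ₗᵢ[ℝ] Euc D
  f : Euc d → Euc k
  f_c2 : ContDiff ℝ 2 f
  f_zero : f 0 = 0
  f'_zero : fderiv ℝ f 0 = 0
  ε : ℝ
  ε_pos : 0 < ε
  graph : M ∩ ball y ε = (Set.range fun u : Euc d => y + J (WithLp.toLp 2 (u, f u))) ∩ ball y ε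

lemma exists_gchart {D d : ℕ} (hdD : d ≤ D) (M : C2CompactSubmanifold D d) {y : Euc D}
    (hy : y ∈ M.carrier) : Nonempty (GChart d (D - d) M.carrier y) := by
  obtain ⟨ε, hε, f, hf, hf0, hf'0, hg⟩ := M.locally_graph y hy
  have hdim : Module.finrank ℝ (M.tangentAt y) = d := M.finrank_tangent y hy
  generalize M.tangentAt y = T at *
  have hdim2 : Module.finrank ℝ (Tᗮ : Submodule ℝ (Euc D)) = D - d := by
    have := T.finrank_add_finrank_orthogonal
    rw [hdim, finrank_euclideanSpace_fin] at this
    omega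
  let a : Euc d ≃ₗᵢ[ℝ] T := ((stdOrthonormalBasis ℝ T).reindex (finCongr hdim)).repr.symm
  let b : Euc (D - d) ≃ₗᵢ[ℝ] (Tᗮ : Submodule ℝ (Euc D)) :=
    ((stdOrthonormalBasis ℝ (Tᗮ : Submodule ℝ (Euc D))).reindex (finCongr hdim2)).repr.symm
  let J : WithLp 2 (Euc d × Euc (D - d)) ≃ₗᵢ[ℝ] Euc D :=
    { (WithLp.linearEquiv 2 ℝ (Euc d × Euc (D - d))) ≪≫ₗ
        (a.toLinearEquiv.prodCongr b.toLinearEquiv) ≪≫ₗ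
        (T.prodEquivOfIsCompl Tᗮ T.isCompl_orthogonal) with
      norm_map' := by
        intro p
        have h1 : ((WithLp.linearEquiv 2 ℝ (Euc d × Euc (D - d))) ≪≫ₗ
          (a.toLinearEquiv.prodCongr b.toLinearEquiv) ≪≫ₗ
          (T.prodEquivOfIsCompl Tᗮ T.isCompl_orthogonal)) p =
            (a p.fst : Euc D) + (b p.snd : Euc D) := by simp
        rw [h1, ← sq_eq_sq₀ (by positivity) (by positivity), WithLp.prod_norm_sq_eq_of_L2,
          norm_add_sq_real, (Submodule.mem_orthogonal T _).1 (b p.snd).2 _ (a p.fst).2]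
        have h2 : ‖(a p.fst : Euc D)‖ = ‖p.fst‖ := a.norm_map p.fst
        have h3 : ‖(b p.snd : Euc D)‖ = ‖p.snd‖ := b.norm_map p.snd
        rw [h2, h3]
        ring }
  have hJ : ∀ u w, J (WithLp.toLp 2 (u, w)) = (a u : Euc D) + (b w : Euc D) := by
    intro u w
    change ((WithLp.linearEquiv 2 ℝ (Euc d × Euc (D - d))) ≪≫ₗ
          (a.toLinearEquiv.prodCongr b.toLinearEquiv) ≪≫ₗ
          (T.prodEquivOfIsCompl Tᗮ T.isCompl_orthogonal)) _ = _
    simp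
  refine ⟨⟨J, fun u => b.symm (f (a u)), ?_, ?_, ?_, ε, hε, ?_⟩⟩
  · exact b.symm.contDiff.comp (hf.comp a.contDiff)
  · simp [hf0]
  · have hfd : HasFDerivAt f (0 : T →L[ℝ] (Tᗮ : Submodule ℝ (Euc D))) (a 0) := by
      rw [map_zero, ← hf'0]
      exact (hf.differentiable (by norm_num)).differentiableAt.hasFDerivAt
    have h2 := (b.symm.toContinuousLinearEquiv.toContinuousLinearMap.hasFDerivAt
      (x := f (a 0))).comp (0 : Euc d)
      (hfd.comp (0 : Euc d) a.toContinuousLinearEquiv.toContinuousLinearMap.hasFDerivAt)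
    have h3 := h2.fderiv
    have h4 : fderiv ℝ (fun u => b.symm (f (a u))) 0 = 0 := by
      refine Eq.trans h3 ?_
      simp
    exact h4
  · rw [hg]
    congr 1
    ext x
    simp only [hJ, Set.mem_range, LinearIsometryEquiv.apply_symm_apply]
    constructor
    · rintro ⟨v, rfl⟩
      exact ⟨a.symm v, by simp [add_assoc]⟩
    · rintro ⟨u, rfl⟩
      exact ⟨a u, by simp [add_assoc]⟩

namespace GChart

variable {D d k : ℕ} {M : Set (Euc D)} {y : Euc D} (c : GChart d k M y)

/-- Affine isometric coordinates. -/
def e (p : Euc d × Euc k) : Euc D := y + c.J (WithLp.toLp 2 p)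

/-- The local parametrization of `M`. -/
def γ (u : Euc d) : Euc D := c.e (u, c.f u)

/-- The adjoint of the derivative of `f`. -/
def A (u : Euc d) : Euc k →L[ℝ] Euc d := ContinuousLinearMap.adjoint (fderiv ℝ c.f u)

/-- The tube parametrization, in coordinates. -/
def G (p : Euc d × Euc k) : Euc d × Euc k := (p.1 - c.A p.1 p.2, c.f p.1 + p.2)

lemma dist_e (p q : Euc d × Euc k) :
    dist (c.e p) (c.e q) ^ 2 = ‖p.1 - q.1‖ ^ 2 + ‖p.2 - q.2‖ ^ 2 := by
  unfold e
  rw [dist_add_left, c.J.dist_map, dist_eq_norm, ← WithLp.toLp_sub, WithLp.prod_norm_sq_eq_of_L2]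
  simp

lemma e_surj : Function.Surjective c.e := by
  intro z
  refine ⟨WithLp.ofLp (c.J.symm (z - y)), ?_⟩
  simp [e]

lemma e_inj : Function.Injective c.e := by
  intro p q h
  have := c.dist_e p q
  rw [h, dist_self] at this
  have h1 : ‖p.1 - q.1‖ = 0 := by nlinarith [sq_nonneg ‖p.1 - q.1‖, sq_nonneg ‖p.2 - q.2‖]
  have h2 : ‖p.2 - q.2‖ = 0 := by nlinarith [sq_nonneg ‖p.1 - q.1‖, sq_nonneg ‖p.2 - q.2‖]
  exact Prod.ext (sub_eq_zero.1 (norm_eq_zero.1 h1)) (sub_eq_zero.1 (norm_eq_zero.1 h2))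

lemma e_mp : MeasurePreserving c.e volume volume := by
  have h1 := WithLp.volume_preserving_toLp (Euc d) (Euc k)
  have h2 := c.J.measurePreserving
  have h3 := measurePreserving_add_left (volume : Measure (Euc D)) y
  exact h3.comp (h2.comp h1)

lemma e_cont : Continuous c.e := by
  unfold e
  exact continuous_const.add (c.J.continuous.comp (WithLp.prod_continuous_toLp 2 _ _))

lemma f_cont : Continuous c.f := c.f_c2.continuous

lemma f_diff : Differentiable ℝ c.f := c.f_c2.differentiable (by norm_num)

lemma γ_cont : Continuous c.γ := c.e_cont.comp (continuous_id.prodMk c.f_cont)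

lemma γ_zero : c.γ 0 = y := by
  have : ((0 : Euc d), (0 : Euc k)) = 0 := rfl
  simp [γ, e, c.f_zero, this]

lemma γ_mem {u : Euc d} (hu : c.γ u ∈ ball y c.ε) : c.γ u ∈ M := by
  have : c.γ u ∈ M ∩ ball y c.ε := by
    rw [c.graph]; exact ⟨⟨u, rfl⟩, hu⟩
  exact this.1

lemma exists_γ {m : Euc D} (hm : m ∈ M) (hb : m ∈ ball y c.ε) : ∃ u, c.γ u = m := by
  have : m ∈ M ∩ ball y c.ε := ⟨hm, hb⟩
  rw [c.graph] at this
  exact this.1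

lemma norm_sub_le_dist_γ (u v : Euc d) : ‖u - v‖ ≤ dist (c.γ u) (c.γ v) := by
  have := c.dist_e (u, c.f u) (v, c.f v)
  refine le_of_sq_le_sq ?_ dist_nonneg
  change _ ≤ dist (c.e _) (c.e _) ^ 2
  rw [this]
  simp only
  nlinarith [sq_nonneg ‖c.f u - c.f v‖]

lemma A_inner (u h : Euc d) (w : Euc k) : ⟪c.A u w, h⟫ = ⟪w, fderiv ℝ c.f u h⟫ := by
  unfold A
  rw [ContinuousLinearMap.adjoint_inner_left]

lemma e_G_line (u : Euc d) (w : Euc k) (t : ℝ) :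
    c.e (c.G (u, t • w)) = c.γ u + t • (c.e (c.G (u, w)) - c.γ u) := by
  have hv : c.G (u, t • w) = (u, c.f u) + t • (c.G (u, w) - (u, c.f u)) := by
    unfold G
    ext1
    · simp only [map_smul, Prod.fst_add, Prod.smul_fst, Prod.fst_sub]
      rw [sub_sub_cancel_left, smul_neg, sub_eq_add_neg]
    · simp
  unfold γ e
  rw [hv]
  simp only [WithLp.toLp_add, WithLp.toLp_smul, WithLp.toLp_sub, map_add, map_smul, map_sub]
  rw [add_sub_add_left_eq_sub, add_assoc]

lemma dist_e_G (u : Euc d) (w : Euc k) :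
    dist (c.e (c.G (u, w))) (c.γ u) ^ 2 = ‖c.A u w‖ ^ 2 + ‖w‖ ^ 2 := by
  unfold γ
  rw [c.dist_e]
  simp [G]

/-- Key expansion of the squared distance to a point of the graph. -/
lemma dist_e_G' (u v : Euc d) (w : Euc k) :
    dist (c.e (c.G (u, w))) (c.γ v) ^ 2 = ‖c.A u w‖ ^ 2 + ‖w‖ ^ 2 + ‖u - v‖ ^ 2
      + ‖c.f u - c.f v‖ ^ 2 - 2 * ⟪w, c.f v - c.f u - fderiv ℝ c.f u (v - u)⟫ := by
  unfold γ
  rw [c.dist_e]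
  have h1 : (c.G (u, w)).1 - v = (u - v) - c.A u w := by simp only [G]; abel
  have h2 : (c.G (u, w)).2 - c.f v = (c.f u - c.f v) + w := by simp only [G]; abel
  simp only [h1, h2]
  rw [norm_sub_sq_real, norm_add_sq_real, inner_sub_right, ← c.A_inner]
  have h3 : ⟪w, c.f v - c.f u⟫ = - ⟪c.f u - c.f v, w⟫ := by
    rw [real_inner_comm, ← inner_neg_left]; congr 1; abel
  have h4 : ⟪c.A u w, v - u⟫ = - ⟪u - v, c.A u w⟫ := by
    rw [real_inner_comm, ← inner_neg_left]; congr 1; abel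
  rw [h3, h4]
  ring

lemma fderiv_c1 : ContDiff ℝ 1 (fderiv ℝ c.f) := c.f_c2.fderiv_right (by norm_num)

lemma taylor (u : Euc d) : ∃ C > 0, ∃ δ > 0, ∀ v, ‖v - u‖ < δ →
    ‖c.f v - c.f u - fderiv ℝ c.f u (v - u)‖ ≤ C * ‖v - u‖ ^ 2 := by
  obtain ⟨K, s, hs, hK⟩ := (c.fderiv_c1.contDiffAt (x := u)).exists_lipschitzOnWith
  obtain ⟨δ, hδ, hball⟩ := Metric.mem_nhds_iff.1 hs
  refine ⟨K + 1, by positivity, δ, hδ, fun v hv => ?_⟩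
  have h1 : ∀ x ∈ closedBall u ‖v - u‖, ‖fderiv ℝ c.f x - fderiv ℝ c.f u‖ ≤ (K + 1) * ‖v - u‖ := by
    intro x hx
    have hx' : ‖x - u‖ ≤ ‖v - u‖ := by rw [← dist_eq_norm]; exact hx
    have := hK.dist_le_mul x (hball (by rw [mem_ball, dist_eq_norm]; linarith)) u
      (hball (mem_ball_self hδ))
    rw [dist_eq_norm, dist_eq_norm] at this
    refine this.trans ?_
    gcongr
    linarith
  have := (convex_closedBall u ‖v - u‖).norm_image_sub_le_of_norm_fderiv_le'
    (fun x _ => c.f_diff x) h1 (mem_closedBall_self (norm_nonneg _))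
    (show v ∈ closedBall u ‖v - u‖ by rw [mem_closedBall, dist_eq_norm])
  refine this.trans (le_of_eq ?_)
  ring

/-- Initial interval: short normal segments project back. -/
lemma init_normal (u : Euc d) (w : Euc k) (hu : c.γ u ∈ ball y c.ε) :
    ∃ t : ℝ, 0 < t ∧ Metric.infDist (c.e (c.G (u, t • w))) M = dist (c.e (c.G (u, t • w))) (c.γ u) := by
  obtain ⟨C, hC, δ, hδ, hT⟩ := c.taylor u
  obtain ⟨ρ, hρ, hρb⟩ := Metric.isOpen_iff.1 isOpen_ball _ hu
  set r := min δ ρ with hr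
  have hr0 : 0 < r := lt_min hδ hρ
  set ν := c.e (c.G (u, w)) - c.γ u with hν
  set t := min (1 / (2 * C * (‖w‖ + 1))) (r / (2 * (‖ν‖ + 1))) with ht
  have ht0 : 0 < t := lt_min (by positivity) (by positivity)
  refine ⟨t, ht0, ?_⟩
  have hmem := c.γ_mem hu
  apply le_antisymm (Metric.infDist_le_dist_of_mem hmem)
  rw [Metric.le_infDist ⟨_, hmem⟩]
  intro m hm
  have hd : dist (c.e (c.G (u, t • w))) (c.γ u) ≤ r / 2 := by
    rw [c.e_G_line, dist_eq_norm, add_sub_cancel_left, norm_smul, Real.norm_of_nonneg ht0.le, ← hν]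
    have h1 : t ≤ r / (2 * (‖ν‖ + 1)) := min_le_right _ _
    calc t * ‖ν‖ ≤ r / (2 * (‖ν‖ + 1)) * (‖ν‖ + 1) := by gcongr; linarith
      _ = r / 2 := by field_simp
  rcases lt_or_ge (dist m (c.γ u)) r with hlt | hge
  · obtain ⟨v, rfl⟩ := c.exists_γ hm (hρb (lt_of_lt_of_le hlt (min_le_right _ _)))
    have hvu : ‖v - u‖ < δ :=
      lt_of_le_of_lt (c.norm_sub_le_dist_γ v u) (lt_of_lt_of_le hlt (min_le_left _ _))
    refine le_of_sq_le_sq ?_ dist_nonneg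
    rw [c.dist_e_G, c.dist_e_G']
    have h2 := hT v hvu
    have h3 : ⟪t • w, c.f v - c.f u - fderiv ℝ c.f u (v - u)⟫ ≤ t * ‖w‖ * (C * ‖v - u‖ ^ 2) := by
      refine (real_inner_le_norm _ _).trans ?_
      rw [norm_smul, Real.norm_of_nonneg ht0.le]
      gcongr
    have h4 : t * ‖w‖ * C ≤ 1 / 2 := by
      have h1 : t ≤ 1 / (2 * C * (‖w‖ + 1)) := min_le_left _ _
      calc t * ‖w‖ * C ≤ 1 / (2 * C * (‖w‖ + 1)) * (‖w‖ + 1) * C := by gcongr; linarith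
        _ = 1 / 2 := by field_simp
    have h5 : ‖u - v‖ = ‖v - u‖ := norm_sub_rev _ _
    rw [h5]
    nlinarith [sq_nonneg ‖c.f u - c.f v‖, sq_nonneg ‖v - u‖]
  · have := dist_triangle_left m (c.γ u) (c.e (c.G (u, t • w)))
    linarith

/-- Normal vectors of length below the reach project back to the foot point. -/
lemma normal_infDist (hM : IsCompact M) {τ : ℝ} (hu : UniqNear M τ) (u : Euc d) (w : Euc k)
    (hub : c.γ u ∈ ball y c.ε) (hlt : dist (c.e (c.G (u, w))) (c.γ u) < τ) :
    Metric.infDist (c.e (c.G (u, w))) M = dist (c.e (c.G (u, w))) (c.γ u) := by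
  obtain ⟨t, ht, h⟩ := c.init_normal u w hub
  have hmem := c.γ_mem hub
  rw [c.e_G_line, dist_eq_norm, add_sub_cancel_left, norm_smul, Real.norm_of_nonneg ht.le] at h
  rw [dist_eq_norm] at hlt ⊢
  have := reach_extend hM ⟨_, hmem⟩ hu hmem hlt ht h
  rwa [add_sub_cancel] at this

/-- Conversely, nearest-point displacements are normal. -/
lemma eq_G_of_near {z : Euc D} {u : Euc d} (hub : c.γ u ∈ ball y c.ε)
    (hz : dist z (c.γ u) = Metric.infDist z M) : ∃ w, z = c.e (c.G (u, w)) := by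
  obtain ⟨⟨a, b⟩, rfl⟩ := c.e_surj z
  refine ⟨b - c.f u, ?_⟩
  have hloc : IsLocalMin (fun v => ‖a - v‖ ^ 2 + ‖b - c.f v‖ ^ 2) u := by
    have : ∀ᶠ v in nhds u, c.γ v ∈ ball y c.ε :=
      c.γ_cont.continuousAt (isOpen_ball.mem_nhds hub)
    filter_upwards [this] with v hv
    have h1 : dist (c.e (a, b)) (c.γ u) ≤ dist (c.e (a, b)) (c.γ v) := by
      rw [hz]; exact Metric.infDist_le_dist_of_mem (c.γ_mem hv)
    have h2 := pow_le_pow_left₀ dist_nonneg h1 2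
    unfold γ at h2
    rwa [c.dist_e, c.dist_e] at h2
  have hder : HasFDerivAt (fun v => ‖a - v‖ ^ 2 + ‖b - c.f v‖ ^ 2)
      (2 • (innerSL ℝ (a - u)).comp (-(ContinuousLinearMap.id ℝ (Euc d)))
        + 2 • (innerSL ℝ (b - c.f u)).comp (-(fderiv ℝ c.f u))) u := by
    apply HasFDerivAt.add
    · exact ((hasFDerivAt_id u).const_sub a).norm_sq
    · exact ((c.f_diff u).hasFDerivAt.const_sub b).norm_sq
  have h0 := hloc.hasFDerivAt_eq_zero hder
  have h1 : a = u - c.A u (b - c.f u) := by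
    have : a - u + c.A u (b - c.f u) = 0 := by
      apply ext_inner_right ℝ
      intro h
      have := congrArg (fun L : Euc d →L[ℝ] ℝ => L h) h0
      simp at this
      rw [inner_add_left, c.A_inner, inner_zero_left]
      simp only [inner_sub_left] at this ⊢
      linarith
    have h2 : a = (a - u + c.A u (b - c.f u)) + (u - c.A u (b - c.f u)) := by abel
    rw [this, zero_add] at h2
    exact h2
  congr 1
  unfold G
  ext1
  · exact h1
  · simp

end GChart

/-! ### Part C: second order bounds and the Jacobian on the normal fibre -/

lemma abs_det_le_of_norm_le {d : ℕ} (B : Euc d →L[ℝ] Euc d) {c : ℝ} (hc : 0 ≤ c)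
    (h : ∀ a, ‖B a‖ ≤ c * ‖a‖) : |B.det| ≤ c ^ d := by
  have h1 : B '' closedBall 0 1 ⊆ closedBall 0 c := by
    rintro _ ⟨a, ha, rfl⟩
    rw [mem_closedBall_zero_iff] at ha ⊢
    exact (h a).trans (by nlinarith)
  have h2 := measure_mono (μ := volume) h1
  rw [Measure.addHaar_image_continuousLinearMap, Measure.addHaar_closedBall _ _ hc,
    Measure.addHaar_closedBall _ _ zero_le_one] at h2
  simp only [one_pow, ENNReal.ofReal_one, one_mul, finrank_euclideanSpace_fin] at h2
  have h3 : (volume (ball (0 : Euc d) 1)) ≠ 0 := (measure_ball_pos _ _ zero_lt_one).ne'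
  have h4 : (volume (ball (0 : Euc d) 1)) ≠ ⊤ := measure_ball_lt_top.ne
  rw [ENNReal.mul_le_mul_iff_left h3 h4] at h2
  exact (ENNReal.ofReal_le_ofReal_iff (by positivity)).1 h2

lemma le_abs_det_of_le_norm {d : ℕ} (B : Euc d →L[ℝ] Euc d) {c : ℝ} (hc : 0 < c)
    (h : ∀ a, c * ‖a‖ ≤ ‖B a‖) : c ^ d ≤ |B.det| := by
  have hinj : Function.Injective B := by
    rw [injective_iff_map_eq_zero]
    intro a ha
    have := h a
    rw [ha, norm_zero] at this
    have : ‖a‖ ≤ 0 := by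
      by_contra hcon
      push Not at hcon
      nlinarith
    exact norm_le_zero_iff.1 this
  have hsurj : Function.Surjective B := (LinearMap.injective_iff_surjective (f := (B : Euc d →ₗ[ℝ] Euc d))).1 hinj
  have h1 : closedBall 0 c ⊆ B '' closedBall 0 1 := by
    intro b hb
    obtain ⟨a, rfl⟩ := hsurj b
    refine ⟨a, ?_, rfl⟩
    rw [mem_closedBall_zero_iff] at hb ⊢
    have := (h a).trans hb
    by_contra hcon
    push Not at hcon
    nlinarith
  have h2 := measure_mono (μ := volume) h1
  rw [Measure.addHaar_image_continuousLinearMap, Measure.addHaar_closedBall _ _ hc.le,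
    Measure.addHaar_closedBall _ _ zero_le_one] at h2
  simp only [one_pow, ENNReal.ofReal_one, one_mul, finrank_euclideanSpace_fin] at h2
  have h3 : (volume (ball (0 : Euc d) 1)) ≠ 0 := (measure_ball_pos _ _ zero_lt_one).ne'
  have h4 : (volume (ball (0 : Euc d) 1)) ≠ ⊤ := measure_ball_lt_top.ne
  rw [ENNReal.mul_le_mul_iff_left h3 h4] at h2
  exact (ENNReal.ofReal_le_ofReal_iff (abs_nonneg _)).1 h2

/-- The adjoint as a real continuous linear map. -/
def adjR (d k : ℕ) : (Euc d →L[ℝ] Euc k) →L[ℝ] (Euc k →L[ℝ] Euc d) :=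
  LinearMap.toContinuousLinearMap
    { toFun := fun B => ContinuousLinearMap.adjoint B
      map_add' := fun x y => map_add _ x y
      map_smul' := fun r x => by simp }

lemma adjR_apply {d k : ℕ} (B : Euc d →L[ℝ] Euc k) :
    adjR d k B = ContinuousLinearMap.adjoint B := rfl

namespace GChart

variable {D d k : ℕ} {M : Set (Euc D)} {y : Euc D} (c : GChart d k M y)

/-- The second derivative of `f` at the origin. -/
def Q : Euc d →L[ℝ] Euc d →L[ℝ] Euc k := fderiv ℝ (fderiv ℝ c.f) 0

lemma Q_symm (a b : Euc d) : c.Q a b = c.Q b a := by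
  have := c.f_c2.contDiffAt (x := 0)
  exact (this.isSymmSndFDerivAt (by simp)).eq a b

lemma f'_hasFDerivAt : HasFDerivAt (fderiv ℝ c.f) c.Q 0 :=
  ((c.fderiv_c1.differentiable (by norm_num)) 0).hasFDerivAt

lemma second_order {η : ℝ} (hη : 0 < η) : ∃ δ > 0, ∀ u, ‖u‖ < δ →
    ‖c.f u - (1/2 : ℝ) • c.Q u u‖ ≤ η * ‖u‖ ^ 2 ∧ ‖c.f u‖ ≤ η * ‖u‖ := by
  have h1 := c.f'_hasFDerivAt.isLittleO.def hη
  have h2 : HasFDerivAt c.f (0 : Euc d →L[ℝ] Euc k) 0 := by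
    rw [← c.f'_zero]; exact (c.f_diff 0).hasFDerivAt
  have h2' := h2.isLittleO.def hη
  obtain ⟨δ, hδ, hb⟩ := Metric.eventually_nhds_iff.1 (h1.and h2')
  refine ⟨δ, hδ, fun u hu => ⟨?_, ?_⟩⟩
  · have hder : ∀ x : Euc d, HasFDerivAt (fun u => c.f u - (1/2 : ℝ) • c.Q u u)
        (fderiv ℝ c.f x - c.Q x) x := by
      intro x
      have h3 : HasFDerivAt (fun u => c.Q u u) (c.Q x + c.Q.flip x) x := by
        have := (c.Q.hasFDerivAt (x := x)).clm_apply (hasFDerivAt_id x)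
        refine this.congr_fderiv ?_
        ext a
        simp
      have h4 := ((c.f_diff x).hasFDerivAt).sub (h3.const_smul (1/2 : ℝ))
      refine h4.congr_fderiv ?_
      have h5 : c.Q.flip x = c.Q x := by
        ext1 a
        rw [ContinuousLinearMap.flip_apply]; exact c.Q_symm a x
      rw [h5]
      congr 1
      rw [← two_smul ℝ, smul_smul]; norm_num
    have hbd : ∀ x ∈ closedBall (0 : Euc d) ‖u‖, ‖fderiv ℝ c.f x - c.Q x‖ ≤ η * ‖u‖ := by
      intro x hx
      rw [mem_closedBall_zero_iff] at hx
      have := (hb (y := x) (by rw [dist_zero_right]; linarith)).1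
      rw [c.f'_zero] at this
      simp only [sub_zero] at this
      exact this.trans (by gcongr)
    have := (convex_closedBall (0 : Euc d) ‖u‖).norm_image_sub_le_of_norm_hasFDerivWithin_le
      (fun x _ => (hder x).hasFDerivWithinAt) hbd (mem_closedBall_self (norm_nonneg _))
      (show u ∈ closedBall (0 : Euc d) ‖u‖ by rw [mem_closedBall_zero_iff])
    simp only [c.f_zero, map_zero, smul_zero, sub_zero] at this
    refine this.trans (le_of_eq (by ring))
  · have := (hb (y := u) (by rw [dist_zero_right]; exact hu)).2
    simpa [c.f_zero] using this

lemma A_zero : c.A 0 = 0 := by simp [A, c.f'_zero]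

lemma Q_upper (hM : IsCompact M) {τ : ℝ} (hu : UniqNear M τ) (w : Euc k) (hw : ‖w‖ < τ)
    (a : Euc d) : ⟪w, c.Q a a⟫ ≤ ‖a‖ ^ 2 := by
  have hyb : c.γ 0 ∈ ball y c.ε := by rw [c.γ_zero]; exact mem_ball_self c.ε_pos
  have hdist : dist (c.e (c.G (0, w))) (c.γ 0) = ‖w‖ := by
    have := c.dist_e_G 0 w
    rw [c.A_zero] at this
    simp at this
    exact (sq_eq_sq₀ dist_nonneg (norm_nonneg _)).1 (by simpa using this)
  have hinf := c.normal_infDist hM hu 0 w hyb (by rw [hdist]; exact hw)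
  -- key inequality with slack
  have key : ∀ η : ℝ, 0 < η → ⟪w, c.Q a a⟫ ≤ ‖a‖ ^ 2 * (1 + η ^ 2 + 2 * ‖w‖ * η) := by
    intro η hη
    obtain ⟨δ, hδ, hs⟩ := c.second_order hη
    have hev : ∀ᶠ v in nhds (0 : Euc d), c.γ v ∈ ball y c.ε :=
      c.γ_cont.continuousAt (isOpen_ball.mem_nhds hyb)
    have hev2 : ∀ᶠ v in nhds (0 : Euc d), ‖v‖ < δ := by
      filter_upwards [Metric.ball_mem_nhds (0 : Euc d) hδ] with v hv
      simpa using hv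
    have hlim : Filter.Tendsto (fun s : ℝ => s • a) (nhdsWithin 0 (Set.Ioi 0)) (nhds 0) := by
      have : Filter.Tendsto (fun s : ℝ => s • a) (nhds 0) (nhds ((0:ℝ) • a)) :=
        (continuous_id.smul continuous_const).tendsto 0
      rw [zero_smul] at this
      exact this.mono_left nhdsWithin_le_nhds
    obtain ⟨s, ⟨hs1, hs2⟩, hs0⟩ :=
      ((hlim.eventually (hev.and hev2)).and self_mem_nhdsWithin).exists
    have hs0' : 0 < s := hs0
    obtain ⟨h1, h2⟩ := hs _ hs2
    have h3 : dist (c.e (c.G (0, w))) (c.γ 0) ^ 2 ≤ dist (c.e (c.G (0, w))) (c.γ (s • a)) ^ 2 := by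
      rw [← hinf]
      have := Metric.infDist_le_dist_of_mem (x := c.e (c.G (0, w))) (c.γ_mem hs1)
      exact pow_le_pow_left₀ Metric.infDist_nonneg this 2
    rw [c.dist_e_G, c.dist_e_G', c.f_zero, c.f'_zero] at h3
    simp only [zero_sub, norm_neg, sub_zero, _root_.zero_apply] at h3
    have h4 : ⟪w, c.f (s • a)⟫ = ⟪w, c.f (s • a) - (1/2 : ℝ) • c.Q (s • a) (s • a)⟫ +
        (1/2) * (s * (s * ⟪w, c.Q a a⟫)) := by
      rw [inner_sub_right, inner_smul_right]
      simp only [map_smul, _root_.smul_apply, inner_smul_right]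
      ring
    have h5 : - (‖w‖ * (η * ‖s • a‖ ^ 2)) ≤
        ⟪w, c.f (s • a) - (1/2 : ℝ) • c.Q (s • a) (s • a)⟫ := by
      have := abs_real_inner_le_norm w (c.f (s • a) - (1/2 : ℝ) • c.Q (s • a) (s • a))
      have h6 : ‖w‖ * ‖c.f (s • a) - (1/2 : ℝ) • c.Q (s • a) (s • a)‖ ≤
        ‖w‖ * (η * ‖s • a‖ ^ 2) := by gcongr
      linarith [neg_abs_le ⟪w, c.f (s • a) - (1/2 : ℝ) • c.Q (s • a) (s • a)⟫]
    have h7 : ‖c.f (s • a)‖ ^ 2 ≤ η ^ 2 * ‖s • a‖ ^ 2 := by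
      rw [← mul_pow]; gcongr
    have h8 : ‖s • a‖ ^ 2 = s ^ 2 * ‖a‖ ^ 2 := by
      rw [norm_smul, mul_pow]; simp
    rw [h8] at h3 h5 h7
    rw [h4] at h3
    have h9 : s ^ 2 * ⟪w, c.Q a a⟫ ≤ s ^ 2 * (‖a‖ ^ 2 * (1 + η ^ 2 + 2 * ‖w‖ * η)) := by
      nlinarith
    exact le_of_mul_le_mul_left h9 (by positivity)
  have hl : Filter.Tendsto (fun η : ℝ => ‖a‖ ^ 2 * (1 + η ^ 2 + 2 * ‖w‖ * η))
      (nhdsWithin 0 (Set.Ioi 0)) (nhds (‖a‖ ^ 2)) := by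
    have : Continuous (fun η : ℝ => ‖a‖ ^ 2 * (1 + η ^ 2 + 2 * ‖w‖ * η)) := by fun_prop
    have := this.tendsto 0
    simp at this
    exact this.mono_left nhdsWithin_le_nhds
  refine ge_of_tendsto hl ?_
  filter_upwards [self_mem_nhdsWithin] with η hη using key η hη

lemma Q_upper' (hM : IsCompact M) {τ σ : ℝ} (hu : UniqNear M τ) (hσ : 0 < σ) (hστ : σ < τ)
    (w : Euc k) (hw : ‖w‖ ≤ σ) (a : Euc d) : ⟪w, c.Q a a⟫ ≤ σ / τ * ‖a‖ ^ 2 := by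
  have hτ : 0 < τ := hσ.trans hστ
  have key : ∀ t, 0 < t → t < τ → t * ⟪w, c.Q a a⟫ ≤ σ * ‖a‖ ^ 2 := by
    intro t ht htτ
    have := c.Q_upper hM hu ((t / σ) • w) (by
      rw [norm_smul, Real.norm_of_nonneg (by positivity)]
      calc t / σ * ‖w‖ ≤ t / σ * σ := by gcongr
        _ = t := by field_simp
        _ < τ := htτ) a
    rw [inner_smul_left] at this
    simp only [conj_trivial] at this
    rw [div_mul_eq_mul_div, div_le_iff₀ hσ] at this
    linarith
  have hl : Filter.Tendsto (fun t : ℝ => t * ⟪w, c.Q a a⟫) (nhdsWithin τ (Set.Iio τ))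
      (nhds (τ * ⟪w, c.Q a a⟫)) :=
    ((continuous_id.mul continuous_const).tendsto τ).mono_left nhdsWithin_le_nhds
  have : τ * ⟪w, c.Q a a⟫ ≤ σ * ‖a‖ ^ 2 := by
    refine le_of_tendsto hl ?_
    filter_upwards [self_mem_nhdsWithin, mem_nhdsWithin_of_mem_nhds (lt_mem_nhds hτ)] with t h1 h2
    exact key t h2 h1
  rw [div_mul_eq_mul_div, le_div_iff₀ hτ]
  linarith

lemma Q_bilin (hM : IsCompact M) {τ σ : ℝ} (hu : UniqNear M τ) (hσ : 0 < σ) (hστ : σ < τ)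
    (w : Euc k) (hw : ‖w‖ ≤ σ) (a b : Euc d) : ⟪w, c.Q a b⟫ ≤ σ / τ * (‖a‖ * ‖b‖) := by
  have hτ : 0 < τ := hσ.trans hστ
  have h1 : ∀ a b : Euc d, 4 * ⟪w, c.Q a b⟫ ≤ σ / τ * (2 * ‖a‖ ^ 2 + 2 * ‖b‖ ^ 2) := by
    intro a b
    have h2 := c.Q_upper' hM hu hσ hστ w hw (a + b)
    have h3 := c.Q_upper' hM hu hσ hστ (-w) (by simpa using hw) (a - b)
    have h4 := parallelogram_law_with_norm ℝ a b
    simp only [map_add, map_sub, _root_.add_apply, _root_.sub_apply,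
      inner_add_right, inner_sub_right, inner_neg_left] at h2 h3
    rw [c.Q_symm b a] at h2 h3
    have h5 : σ / τ * ‖a + b‖ ^ 2 + σ / τ * ‖a - b‖ ^ 2 = σ / τ * (2 * ‖a‖ ^ 2 + 2 * ‖b‖ ^ 2) := by
      rw [← mul_add]; congr 1; nlinarith
    linarith
  rcases eq_or_ne a 0 with rfl | ha
  · simp
  rcases eq_or_ne b 0 with rfl | hb
  · simp
  have ha' : 0 < ‖a‖ := norm_pos_iff.2 ha
  have hb' : 0 < ‖b‖ := norm_pos_iff.2 hb
  have := h1 (‖b‖ • a) (‖a‖ • b)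
  simp only [map_smul, _root_.smul_apply, inner_smul_right, norm_smul, norm_norm] at this
  have h6 : (‖a‖ * ‖b‖) * ⟪w, c.Q a b⟫ ≤ (‖a‖ * ‖b‖) * (σ / τ * (‖a‖ * ‖b‖)) := by nlinarith
  exact le_of_mul_le_mul_left h6 (by positivity)

/-- The shape operator at `y` in direction `w`. -/
def L (w : Euc k) : Euc d →L[ℝ] Euc d := ((adjR d k).comp c.Q).flip w

lemma norm_L_le (hM : IsCompact M) {τ σ : ℝ} (hu : UniqNear M τ) (hσ : 0 < σ) (hστ : σ < τ)
    (w : Euc k) (hw : ‖w‖ ≤ σ) (a : Euc d) : ‖c.L w a‖ ≤ σ / τ * ‖a‖ := by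
  have h1 : ⟪c.L w a, c.L w a⟫ = ⟪w, c.Q a (c.L w a)⟫ := by
    conv_lhs => lhs; simp only [L, ContinuousLinearMap.flip_apply, ContinuousLinearMap.comp_apply, adjR_apply]
    rw [ContinuousLinearMap.adjoint_inner_left]
  have h2 := c.Q_bilin hM hu hσ hστ w hw a (c.L w a)
  rw [← h1, real_inner_self_eq_norm_sq] at h2
  rcases eq_or_ne (c.L w a) 0 with h0 | h0
  · rw [h0, norm_zero]
    have : 0 < τ := hσ.trans hστ
    positivity
  · have h3 : 0 < ‖c.L w a‖ := norm_pos_iff.2 h0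
    have : ‖c.L w a‖ * ‖c.L w a‖ ≤ ‖c.L w a‖ * (σ / τ * ‖a‖) := by nlinarith
    exact le_of_mul_le_mul_left this h3

lemma G_c1 : ContDiff ℝ 1 c.G := by
  have h1 : ContDiff ℝ 1 (fun p : Euc d × Euc k => adjR d k (fderiv ℝ c.f p.1) p.2) :=
    ((adjR d k).contDiff.comp (c.fderiv_c1.comp contDiff_fst)).clm_apply contDiff_snd
  have h2 : ContDiff ℝ 1 (fun p : Euc d × Euc k => c.f p.1) :=
    (c.f_c2.of_le (by norm_num)).comp contDiff_fst
  exact (contDiff_fst.sub h1).prodMk (h2.add contDiff_snd)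

lemma G_hasFDerivAt (w : Euc k) : HasFDerivAt c.G
    ((ContinuousLinearMap.id ℝ (Euc d) - c.L w).prodMap (ContinuousLinearMap.id ℝ (Euc k))) (0, w) := by
  have hfst : HasFDerivAt (fun p : Euc d × Euc k => p.1) (ContinuousLinearMap.fst ℝ (Euc d) (Euc k)) (0, w) :=
    hasFDerivAt_fst
  have hsnd : HasFDerivAt (fun p : Euc d × Euc k => p.2) (ContinuousLinearMap.snd ℝ (Euc d) (Euc k)) (0, w) :=
    hasFDerivAt_snd
  have h1 : HasFDerivAt (fun p : Euc d × Euc k => adjR d k (fderiv ℝ c.f p.1))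
      (((adjR d k).comp c.Q).comp (ContinuousLinearMap.fst ℝ (Euc d) (Euc k))) (0, w) := by
    have ha : HasFDerivAt (fun u : Euc d => adjR d k (fderiv ℝ c.f u)) ((adjR d k).comp c.Q) 0 :=
      (adjR d k).hasFDerivAt.comp (0 : Euc d) c.f'_hasFDerivAt
    exact HasFDerivAt.comp (0, w) (g := fun u : Euc d => adjR d k (fderiv ℝ c.f u)) ha hfst
  have h2 := h1.clm_apply hsnd
  have h3 : HasFDerivAt (fun p : Euc d × Euc k => c.f p.1)
      (0 : Euc d × Euc k →L[ℝ] Euc k) (0, w) := by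
    have ha : HasFDerivAt c.f (0 : Euc d →L[ℝ] Euc k) 0 := by
      rw [← c.f'_zero]; exact (c.f_diff 0).hasFDerivAt
    have := HasFDerivAt.comp (0, w) (g := c.f) (f := fun p : Euc d × Euc k => p.1) ha hfst
    exact this.congr_fderiv (ContinuousLinearMap.zero_comp _)
  have h4 := (hfst.sub h2).prodMk (h3.add hsnd)
  refine h4.congr_fderiv ?_
  ext1 
  · ext1 a
    simp [L, c.f'_zero]
  · ext1 b
    simp [L, c.f'_zero]

lemma det_prodMap_id {d k : ℕ} (B : Euc d →L[ℝ] Euc d) :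
    (B.prodMap (ContinuousLinearMap.id ℝ (Euc k))).det = B.det := by
  have : ((B.prodMap (ContinuousLinearMap.id ℝ (Euc k)) : _ →L[ℝ] _) : _ →ₗ[ℝ] _) =
      (B : Euc d →ₗ[ℝ] Euc d).prodMap (LinearMap.id : Euc k →ₗ[ℝ] Euc k) := rfl
  rw [ContinuousLinearMap.det, this, LinearMap.det_prodMap, LinearMap.det_id, mul_one]

lemma det_bounds (hM : IsCompact M) {τ σ : ℝ} (hu : UniqNear M τ) (hσ : 0 < σ) (hστ : σ < τ)
    (w : Euc k) (hw : ‖w‖ ≤ σ) :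
    (1 - σ / τ) ^ d ≤ |(fderiv ℝ c.G (0, w)).det| ∧
      |(fderiv ℝ c.G (0, w)).det| ≤ (1 + σ / τ) ^ d := by
  have hτ : 0 < τ := hσ.trans hστ
  rw [(c.G_hasFDerivAt w).fderiv, det_prodMap_id]
  constructor
  · apply le_abs_det_of_le_norm
    · rw [sub_pos, div_lt_one hτ]; exact hστ
    · intro a
      have h1 := c.norm_L_le hM hu hσ hστ w hw a
      have h2 := norm_sub_norm_le a (c.L w a)
      simp only [_root_.sub_apply, ContinuousLinearMap.id_apply]
      linarith
  · apply abs_det_le_of_norm_le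
    · positivity
    · intro a
      have h1 := c.norm_L_le hM hu hσ hστ w hw a
      have h2 := norm_sub_le a (c.L w a)
      simp only [_root_.sub_apply, ContinuousLinearMap.id_apply]
      linarith

end GChart

/-! ### Part D: local volume estimates -/

namespace GChart

variable {D d k : ℕ} {M : Set (Euc D)} {y : Euc D} (c : GChart d k M y)

lemma det_nhds (hM : IsCompact M) {τ σ : ℝ} (hu : UniqNear M τ) (hσ : 0 < σ) (hστ : σ < τ)
    {η : ℝ} (hη : 1 < η) : ∃ δ > 0, ∀ u w, ‖u‖ < δ → ‖w‖ ≤ σ →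
      (1 - σ / τ) ^ d ≤ η * |(fderiv ℝ c.G (u, w)).det| ∧
        |(fderiv ℝ c.G (u, w)).det| ≤ η * (1 + σ / τ) ^ d := by
  have hτ : 0 < τ := hσ.trans hστ
  have hcont : Continuous (fun p => |(fderiv ℝ c.G p).det|) :=
    (ContinuousLinearMap.continuous_det.comp (c.G_c1.continuous_fderiv (by norm_num))).abs
  let O : Set (Euc d × Euc k) := {p | (1 - σ / τ) ^ d < η * |(fderiv ℝ c.G p).det|} ∩
    {p | |(fderiv ℝ c.G p).det| < η * (1 + σ / τ) ^ d}
  have hO : IsOpen O := (isOpen_lt continuous_const (continuous_const.mul hcont)).inter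
    (isOpen_lt hcont continuous_const)
  let K : Set (Euc d × Euc k) := {0} ×ˢ closedBall 0 σ
  have hK : IsCompact K := isCompact_singleton.prod (isCompact_closedBall _ _)
  have hKO : K ⊆ O := by
    rintro ⟨u, w⟩ ⟨h1, h2⟩
    obtain rfl : u = 0 := h1
    have hw : ‖w‖ ≤ σ := by simpa using h2
    obtain ⟨h3, h4⟩ := c.det_bounds hM hu hσ hστ w hw
    have h5 : 0 < (1 - σ / τ) ^ d := by
      apply pow_pos
      rw [sub_pos, div_lt_one hτ]; exact hστ
    have h6 : 0 < (1 + σ / τ) ^ d := by positivity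
    constructor
    · change (1 - σ / τ) ^ d < η * |(fderiv ℝ c.G (0, w)).det|
      nlinarith
    · change |(fderiv ℝ c.G (0, w)).det| < η * (1 + σ / τ) ^ d
      nlinarith
  obtain ⟨δ, hδ, hsub⟩ := hK.exists_thickening_subset_open hO hKO
  refine ⟨δ, hδ, fun u w h1 h2 => ?_⟩
  have hmem : (u, w) ∈ O := by
    apply hsub
    rw [Metric.mem_thickening_iff]
    refine ⟨(0, w), ⟨rfl, by simpa using h2⟩, ?_⟩
    rw [Prod.dist_eq]
    simpa using h1
  exact ⟨hmem.1.le, hmem.2.le⟩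

lemma small_nhds {η : ℝ} (hη : 1 < η) : ∃ δ > 0,
    (∀ u, ‖u‖ < δ → ‖fderiv ℝ c.f u‖ ≤ η - 1) ∧
    (∀ u, ‖u‖ < δ → c.γ u ∈ ball y c.ε) := by
  have h1 : ∀ᶠ u in nhds (0 : Euc d), ‖fderiv ℝ c.f u‖ < η - 1 := by
    have hc : Continuous (fun u => ‖fderiv ℝ c.f u‖) := c.fderiv_c1.continuous.norm
    have := hc.tendsto 0
    rw [c.f'_zero, norm_zero] at this
    exact this.eventually (gt_mem_nhds (by linarith))
  have hyb : c.γ 0 ∈ ball y c.ε := by rw [c.γ_zero]; exact mem_ball_self c.ε_pos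
  have h2 : ∀ᶠ v in nhds (0 : Euc d), c.γ v ∈ ball y c.ε :=
    c.γ_cont.continuousAt (isOpen_ball.mem_nhds hyb)
  obtain ⟨δ, hδ, hb⟩ := Metric.eventually_nhds_iff.1 (h1.and h2)
  exact ⟨δ, hδ, fun u hu => (hb (by simpa using hu)).1.le, fun u hu => (hb (by simpa using hu)).2⟩

lemma γ_lipschitz {η δ : ℝ} (hη : 1 < η) (h : ∀ u, ‖u‖ < δ → ‖fderiv ℝ c.f u‖ ≤ η - 1) :
    LipschitzOnWith η.toNNReal c.γ (ball 0 δ) := by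
  apply LipschitzOnWith.of_dist_le_mul
  intro u hu v hv
  rw [Real.coe_toNNReal _ (by linarith)]
  have h1 := (convex_ball (0 : Euc d) δ).norm_image_sub_le_of_norm_fderiv_le (𝕜 := ℝ) (f := c.f)
    (fun x _ => c.f_diff x) (fun x hx => h x (by simpa using hx)) hv hu
  refine le_of_sq_le_sq ?_ (mul_nonneg (by linarith) dist_nonneg)
  unfold γ
  rw [c.dist_e, dist_eq_norm]
  have h2 : ‖c.f u - c.f v‖ ^ 2 ≤ ((η - 1) * ‖u - v‖) ^ 2 := by gcongr
  simp only
  nlinarith [sq_nonneg ‖u - v‖, mul_nonneg (sub_nonneg.2 hη.le) (sq_nonneg ‖u - v‖)]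

lemma dist_e_G_le {η δ : ℝ} (hη : 1 < η) (h : ∀ u, ‖u‖ < δ → ‖fderiv ℝ c.f u‖ ≤ η - 1)
    {u : Euc d} (hu : ‖u‖ < δ) (w : Euc k) : dist (c.e (c.G (u, w))) (c.γ u) ≤ η * ‖w‖ := by
  refine le_of_sq_le_sq ?_ (mul_nonneg (by linarith) (norm_nonneg _))
  rw [c.dist_e_G]
  have h1 : ‖c.A u w‖ ≤ (η - 1) * ‖w‖ := by
    refine ((c.A u).le_opNorm w).trans ?_
    have : ‖c.A u‖ = ‖fderiv ℝ c.f u‖ := by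
      unfold A; exact LinearIsometryEquiv.norm_map _ _
    rw [this]
    gcongr
    exact h u hu
  have h2 : ‖c.A u w‖ ^ 2 ≤ ((η - 1) * ‖w‖) ^ 2 := by gcongr
  nlinarith [sq_nonneg ‖w‖, mul_nonneg (sub_nonneg.2 hη.le) (sq_nonneg ‖w‖)]

lemma norm_le_dist_e_G (u : Euc d) (w : Euc k) : ‖w‖ ≤ dist (c.e (c.G (u, w))) (c.γ u) := by
  refine le_of_sq_le_sq ?_ dist_nonneg
  rw [c.dist_e_G]
  nlinarith [sq_nonneg ‖c.A u w‖]

lemma vol_image_e (S : Set (Euc d × Euc k)) : volume (c.e '' S) = volume S := by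
  have h := c.e_mp.measure_preimage_emb (c.e_cont.measurableEmbedding c.e_inj) (c.e '' S)
  rw [c.e_inj.preimage_image] at h
  exact h.symm

lemma γ_anti : AntilipschitzWith 1 c.γ := by
  apply AntilipschitzWith.of_le_mul_dist
  intro u v
  rw [dist_eq_norm]
  simpa using c.norm_sub_le_dist_γ u v

lemma local_bounds (c : GChart d k M y) (hM : IsCompact M) {τ σ : ℝ} (hu : UniqNear M τ) (hσ : 0 < σ) (hστ : σ < τ)
    (P : Euc D → Euc D) (hPmeas : Measurable P)
    (hP : ∀ x ∈ tube M σ, P x ∈ M ∧ dist x (P x) = Metric.infDist x M)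
    {κ : ℝ≥0∞} (hκ : (volume : Measure (Euc d)) = κ • μH[(d : ℝ)])
    {η : ℝ} (hη : 1 < η) :
    ∃ W : Set (Euc D), IsOpen W ∧ y ∈ W ∧ ∀ A : Set (Euc D), MeasurableSet A → A ⊆ M ∩ W →
      volume (P ⁻¹' A ∩ tube M σ) ≤ ENNReal.ofReal η *
        (ENNReal.ofReal ((1 + σ / τ) ^ d) * (κ * volume (ball (0 : Euc k) σ)) * μH[(d : ℝ)] A) ∧
      ENNReal.ofReal ((1 - σ / τ) ^ d) * (κ * volume (ball (0 : Euc k) σ)) * μH[(d : ℝ)] A ≤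
        ENNReal.ofReal η ^ (d + k + 1) * volume (P ⁻¹' A ∩ tube M σ) := by
  have hτ : 0 < τ := hσ.trans hστ
  have hη0 : 0 < η := by linarith
  obtain ⟨δ₁, hδ₁, hdet⟩ := c.det_nhds hM hu hσ hστ hη
  obtain ⟨δ₂, hδ₂, hsm, hball⟩ := c.small_nhds hη
  set δ := min δ₁ δ₂ with hδdef
  have hδ : 0 < δ := lt_min hδ₁ hδ₂
  have hδ1 : δ ≤ δ₁ := min_le_left _ _
  have hδ2 : δ ≤ δ₂ := min_le_right _ _
  refine ⟨ball y (min δ c.ε), isOpen_ball, mem_ball_self (lt_min hδ c.ε_pos), ?_⟩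
  intro A hA hAW
  set B : Set (Euc d) := c.γ ⁻¹' A ∩ ball 0 δ with hB
  have hBm : MeasurableSet B := (c.γ_cont.measurable hA).inter measurableSet_ball
  have hBδ : ∀ u ∈ B, ‖u‖ < δ := fun u hu => by simpa using hu.2
  have hfoot : ∀ m ∈ A, ∃ u ∈ B, c.γ u = m := by
    intro m hm
    obtain ⟨hmM, hmW⟩ := hAW hm
    rw [mem_ball] at hmW
    obtain ⟨u, rfl⟩ := c.exists_γ hmM (lt_of_lt_of_le hmW (min_le_right _ _))
    refine ⟨u, ⟨hm, ?_⟩, rfl⟩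
    have h1 := c.norm_sub_le_dist_γ u 0
    rw [c.γ_zero, sub_zero] at h1
    rw [mem_ball_zero_iff]
    exact h1.trans_lt (lt_of_lt_of_le hmW (min_le_left _ _))
  have hγB : c.γ '' B = A := by
    apply Set.Subset.antisymm
    · rintro _ ⟨u, hu, rfl⟩; exact hu.1
    · intro m hm
      obtain ⟨u, hu, h⟩ := hfoot m hm
      exact ⟨u, hu, h⟩
  have hHle : μH[(d : ℝ)] B ≤ μH[(d : ℝ)] A := by
    have := c.γ_anti.le_hausdorffMeasure_image (d := (d : ℝ)) (by positivity) B
    rw [hγB] at this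
    simpa using this
  have hHge : μH[(d : ℝ)] A ≤ ENNReal.ofReal η ^ d * μH[(d : ℝ)] B := by
    have := ((c.γ_lipschitz hη hsm).mono (s := B) (by
      intro u hu
      have := hBδ u hu
      rw [mem_ball_zero_iff]
      linarith)).hausdorffMeasure_image_le (d := (d : ℝ)) (by positivity)
    rw [hγB, ENNReal.rpow_natCast] at this
    exact this
  have hHaar : (volume : Measure (Euc d × Euc k)).IsAddHaarMeasure := by
    rw [Measure.volume_eq_prod]
    infer_instance
  have hvolB : volume B = κ * μH[(d : ℝ)] B := by rw [hκ]; rfl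
  have hder : ∀ S : Set (Euc d × Euc k), ∀ x ∈ S, HasFDerivWithinAt c.G (fderiv ℝ c.G x) S x :=
    fun S x _ => ((c.G_c1.differentiable (by norm_num)) x).hasFDerivAt.hasFDerivWithinAt
  constructor
  · set S : Set (Euc d × Euc k) := B ×ˢ ball 0 σ with hS
    have hSm : MeasurableSet S := hBm.prod measurableSet_ball
    have hsub : P ⁻¹' A ∩ tube M σ ⊆ c.e '' (c.G '' S) := by
      rintro z ⟨hzA, hzt⟩
      obtain ⟨u, hu, hγu⟩ := hfoot (P z) hzA
      have hnear : dist z (c.γ u) = Metric.infDist z M := by rw [hγu]; exact (hP z hzt).2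
      obtain ⟨w, rfl⟩ := c.eq_G_of_near (hball u (by linarith [hBδ u hu])) hnear
      refine ⟨_, ⟨(u, w), ⟨hu, ?_⟩, rfl⟩, rfl⟩
      rw [mem_ball_zero_iff]
      have h1 := c.norm_le_dist_e_G u w
      rw [hnear] at h1
      exact h1.trans_lt hzt
    calc volume (P ⁻¹' A ∩ tube M σ) ≤ volume (c.e '' (c.G '' S)) := measure_mono hsub
      _ = volume (c.G '' S) := c.vol_image_e _
      _ ≤ ∫⁻ x in S, ENNReal.ofReal |(fderiv ℝ c.G x).det| :=
          addHaar_image_le_lintegral_abs_det_fderiv volume hSm (hder S)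
      _ ≤ ∫⁻ x in S, ENNReal.ofReal (η * (1 + σ / τ) ^ d) := by
          refine setLIntegral_mono measurable_const ?_
          rintro ⟨u, w⟩ ⟨h1, h2⟩
          apply ENNReal.ofReal_le_ofReal
          have h2' : ‖w‖ < σ := by simpa using h2
          exact (hdet u w (by linarith [hBδ u h1]) h2'.le).2
      _ = ENNReal.ofReal (η * (1 + σ / τ) ^ d) * (volume B * volume (ball (0 : Euc k) σ)) := by
          rw [setLIntegral_const, hS, Measure.volume_eq_prod, Measure.prod_prod]
      _ = ENNReal.ofReal η * (ENNReal.ofReal ((1 + σ / τ) ^ d) *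
            (κ * volume (ball (0 : Euc k) σ)) * μH[(d : ℝ)] B) := by
          rw [hvolB, ENNReal.ofReal_mul hη0.le]; ring
      _ ≤ _ := by gcongr
  · set S : Set (Euc d × Euc k) := B ×ˢ ball 0 (σ / η) with hS
    have hSm : MeasurableSet S := hBm.prod measurableSet_ball
    have hfib : ∀ u w, u ∈ B → ‖w‖ < σ / η →
        c.e (c.G (u, w)) ∈ tube M σ ∧ P (c.e (c.G (u, w))) = c.γ u := by
      intro u w hu' hw
      have hub := hball u (by linarith [hBδ u hu'])
      have h1 := c.dist_e_G_le hη hsm (u := u) (by linarith [hBδ u hu']) w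
      have h2 : η * ‖w‖ < σ := by
        rw [lt_div_iff₀ hη0] at hw; linarith
      have h3 := c.normal_infDist hM hu u w hub (by linarith)
      have ht : c.e (c.G (u, w)) ∈ tube M σ := by
        change Metric.infDist _ _ < σ
        rw [h3]; linarith
      refine ⟨ht, ?_⟩
      exact (hu _ (by rw [h3]; linarith)).unique (hP _ ht) ⟨c.γ_mem hub, h3.symm⟩
    have hsub : c.e '' (c.G '' S) ⊆ P ⁻¹' A ∩ tube M σ := by
      rintro _ ⟨_, ⟨⟨u, w⟩, ⟨h1, h2⟩, rfl⟩, rfl⟩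
      obtain ⟨h3, h4⟩ := hfib u w h1 (by simpa using h2)
      refine ⟨?_, h3⟩
      rw [Set.mem_preimage, h4]
      exact h1.1
    have hinj : Set.InjOn c.G S := by
      rintro ⟨u, w⟩ ⟨h1, h2⟩ ⟨u', w'⟩ ⟨h1', h2'⟩ heq
      have h3 := (hfib u w h1 (by simpa using h2)).2
      have h4 := (hfib u' w' h1' (by simpa using h2')).2
      rw [heq, h4] at h3
      have huu : u' = u := c.γ_anti.injective h3
      subst huu
      have := congrArg Prod.snd heq
      simp only [G] at this
      rw [add_left_cancel this]
    have hballs : volume (ball (0 : Euc k) σ) =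
        ENNReal.ofReal η ^ k * volume (ball (0 : Euc k) (σ / η)) := by
      have h := Measure.addHaar_ball_mul_of_pos (volume : Measure (Euc k)) 0 hη0 (σ / η)
      rw [mul_div_cancel₀ _ hη0.ne', finrank_euclideanSpace_fin, ENNReal.ofReal_pow hη0.le] at h
      exact h
    have hintg : ENNReal.ofReal ((1 - σ / τ) ^ d) * (volume B * volume (ball (0 : Euc k) (σ / η))) ≤
        ENNReal.ofReal η * volume (P ⁻¹' A ∩ tube M σ) := by
      calc _ = ∫⁻ x in S, ENNReal.ofReal ((1 - σ / τ) ^ d) := by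
            rw [setLIntegral_const, hS, Measure.volume_eq_prod, Measure.prod_prod]
        _ ≤ ∫⁻ x in S, ENNReal.ofReal η * ENNReal.ofReal |(fderiv ℝ c.G x).det| := by
            refine setLIntegral_mono' hSm ?_
            rintro ⟨u, w⟩ ⟨h1, h2⟩
            rw [← ENNReal.ofReal_mul hη0.le]
            apply ENNReal.ofReal_le_ofReal
            have h2' : ‖w‖ < σ / η := by simpa using h2
            have h3 : σ / η ≤ σ := div_le_self hσ.le hη.le
            exact (hdet u w (by linarith [hBδ u h1]) (by linarith)).1
        _ = ENNReal.ofReal η * ∫⁻ x in S, ENNReal.ofReal |(fderiv ℝ c.G x).det| :=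
            lintegral_const_mul' _ _ ENNReal.ofReal_ne_top
        _ = ENNReal.ofReal η * volume (c.e '' (c.G '' S)) := by
            rw [c.vol_image_e, lintegral_abs_det_fderiv_eq_addHaar_image volume hSm (hder S) hinj]
        _ ≤ _ := by gcongr
    calc ENNReal.ofReal ((1 - σ / τ) ^ d) * (κ * volume (ball (0 : Euc k) σ)) * μH[(d : ℝ)] A
        ≤ ENNReal.ofReal ((1 - σ / τ) ^ d) * (κ * volume (ball (0 : Euc k) σ)) *
          (ENNReal.ofReal η ^ d * μH[(d : ℝ)] B) := by gcongr
      _ = ENNReal.ofReal η ^ (d + k) * (ENNReal.ofReal ((1 - σ / τ) ^ d) *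
          (volume B * volume (ball (0 : Euc k) (σ / η)))) := by
          rw [hballs, hvolB, pow_add]; ring
      _ ≤ ENNReal.ofReal η ^ (d + k) * (ENNReal.ofReal η * volume (P ⁻¹' A ∩ tube M σ)) := by gcongr
      _ = _ := by rw [pow_succ, mul_assoc]

end GChart

/-! ### Part E: globalization and conclusion -/

lemma lim_aux {X Y : ℝ≥0∞} (n : ℕ) (h : ∀ η : ℝ, 1 < η → X ≤ ENNReal.ofReal η ^ n * Y) :
    X ≤ Y := by
  have h0 : Filter.Tendsto (fun η : ℝ => ENNReal.ofReal η) (nhdsWithin 1 (Set.Ioi 1))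
      (nhds 1) := by
    have := (ENNReal.continuous_ofReal.tendsto 1).mono_left
      (nhdsWithin_le_nhds (a := (1 : ℝ)) (s := Set.Ioi 1))
    simpa using this
  have h1 : Filter.Tendsto (fun η : ℝ => ENNReal.ofReal η ^ n) (nhdsWithin 1 (Set.Ioi 1))
      (nhds 1) := by
    have := ((ENNReal.continuous_pow n).tendsto 1).comp h0
    simpa [Function.comp_def] using this
  have h2 : Filter.Tendsto (fun η : ℝ => ENNReal.ofReal η ^ n * Y) (nhdsWithin 1 (Set.Ioi 1))
      (nhds Y) := by
    have := ENNReal.Tendsto.mul_const (b := Y) h1 (Or.inl one_ne_zero)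
    simpa using this
  refine ge_of_tendsto h2 ?_
  filter_upwards [self_mem_nhdsWithin] with η hη
  exact h η hη

lemma loc_glob {D : ℕ} {M : Set (Euc D)} (hM : IsCompact M) (μ ν : Measure (Euc D))
    (h : ∀ y ∈ M, ∃ W : Set (Euc D), IsOpen W ∧ y ∈ W ∧
      ∀ A : Set (Euc D), MeasurableSet A → A ⊆ M ∩ W → μ A ≤ ν A) :
    ∀ A : Set (Euc D), MeasurableSet A → A ⊆ M → μ A ≤ ν A := by
  have key : ∃ U : Set (Euc D), MeasurableSet U ∧ M ⊆ U ∧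
      ∀ A : Set (Euc D), MeasurableSet A → A ⊆ M ∩ U → μ A ≤ ν A := by
    refine hM.induction_on (p := fun s => ∃ U : Set (Euc D), MeasurableSet U ∧ s ⊆ U ∧
      ∀ A : Set (Euc D), MeasurableSet A → A ⊆ M ∩ U → μ A ≤ ν A) ?_ ?_ ?_ ?_
    · refine ⟨∅, MeasurableSet.empty, subset_rfl, fun A _ hA => ?_⟩
      have : A = ∅ := by simpa using hA
      simp [this]
    · rintro s t hst ⟨U, hU, htU, hA⟩
      exact ⟨U, hU, hst.trans htU, hA⟩
    · rintro s t ⟨U, hU, hsU, hA⟩ ⟨U', hU', htU', hA'⟩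
      refine ⟨U ∪ U', hU.union hU', Set.union_subset_union hsU htU', fun A hAm hAs => ?_⟩
      rw [← measure_inter_add_sdiff A hU, ← measure_inter_add_sdiff (μ := ν) A hU]
      refine add_le_add (hA _ (hAm.inter hU) ?_) (hA' _ (hAm.diff hU) ?_)
      · rintro x ⟨hx, hxU⟩
        exact ⟨(hAs hx).1, hxU⟩
      · rintro x ⟨hx, hxU⟩
        exact ⟨(hAs hx).1, (hAs hx).2.resolve_left hxU⟩
    · intro y hy
      obtain ⟨W, hW, hyW, hA⟩ := h y hy
      exact ⟨W, mem_nhdsWithin_of_mem_nhds (hW.mem_nhds hyW), W, hW.measurableSet, subset_rfl, hA⟩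
  obtain ⟨U, -, hMU, hA⟩ := key
  exact fun A hAm hAM => hA A hAm fun x hx => ⟨hAM hx, hMU (hAM hx)⟩

lemma exists_kappa (d : ℕ) : ∃ κ : ℝ≥0∞, κ ≠ 0 ∧ κ ≠ ⊤ ∧
    (volume : Measure (Euc d)) = κ • μH[(d : ℝ)] := by
  refine ⟨(Measure.addHaarScalarFactor (volume : Measure (Euc d)) μH[(d : ℝ)] : ℝ≥0∞), ?_,
    ENNReal.coe_ne_top, ?_⟩
  · exact_mod_cast Measure.addHaarScalarFactor_volume_hausdorffMeasure_ne_zero d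
  · exact Measure.isAddLeftInvariant_eq_smul (volume : Measure (Euc d)) μH[(d : ℝ)]

lemma norm_lower {a b K h v HA VA : ℝ≥0∞} (hb : b ≠ 0) (hb' : b ≠ ⊤) (hK : K ≠ 0) (hK' : K ≠ ⊤)
    (hv : v ≤ b * K * h) (hVA : a * K * HA ≤ VA) :
    a * b⁻¹ * (h⁻¹ * HA) ≤ v⁻¹ * VA := by
  calc a * b⁻¹ * (h⁻¹ * HA) = (K⁻¹ * K) * (a * b⁻¹ * (h⁻¹ * HA)) := by
        rw [ENNReal.inv_mul_cancel hK hK', one_mul]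
    _ = (b⁻¹ * K⁻¹ * h⁻¹) * (a * K * HA) := by ring
    _ = (b * K * h)⁻¹ * (a * K * HA) := by
        rw [ENNReal.mul_inv (Or.inl (mul_ne_zero hb hK)) (Or.inl (ENNReal.mul_ne_top hb' hK')),
          ENNReal.mul_inv (Or.inl hb) (Or.inl hb')]
    _ ≤ v⁻¹ * VA := mul_le_mul' (ENNReal.inv_le_inv.2 hv) hVA

lemma norm_upper {a b K h v HA VA : ℝ≥0∞} (ha : a ≠ 0) (ha' : a ≠ ⊤) (hK : K ≠ 0) (hK' : K ≠ ⊤)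
    (hv : a * K * h ≤ v) (hVA : VA ≤ b * K * HA) :
    v⁻¹ * VA ≤ b * a⁻¹ * (h⁻¹ * HA) := by
  calc v⁻¹ * VA ≤ (a * K * h)⁻¹ * (b * K * HA) := mul_le_mul' (ENNReal.inv_le_inv.2 hv) hVA
    _ = (a⁻¹ * K⁻¹ * h⁻¹) * (b * K * HA) := by
        rw [ENNReal.mul_inv (Or.inl (mul_ne_zero ha hK)) (Or.inl (ENNReal.mul_ne_top ha' hK')),
          ENNReal.mul_inv (Or.inl ha) (Or.inl ha')]
    _ = (K⁻¹ * K) * (b * a⁻¹ * (h⁻¹ * HA)) := by ring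
    _ = _ := by rw [ENNReal.inv_mul_cancel hK hK', one_mul]

lemma ofReal_quot {x y τ : ℝ} (hτ : 0 < τ) (hx : 0 < x) (hy : 0 < y) (d : ℕ) :
    ENNReal.ofReal ((x / y) ^ d) =
      ENNReal.ofReal ((x / τ) ^ d) * (ENNReal.ofReal ((y / τ) ^ d))⁻¹ := by
  rw [← ENNReal.ofReal_inv_of_pos (by positivity), ← ENNReal.ofReal_mul (by positivity),
    ← inv_pow, ← mul_pow]
  congr 2
  field_simp

lemma main_bounds {D d : ℕ} (hdD : d ≤ D)
    (M : C2CompactSubmanifold D d) (τ σ : ℝ)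
    (hτ : 0 < τ) (hreach : reach M.carrier = τ) (hσ0 : 0 < σ) (hστ : σ < τ)
    (P : Euc D → Euc D) (hPmeas : Measurable P)
    (hP : ∀ x ∈ tube M.carrier σ,
      P x ∈ M.carrier ∧ dist x (P x) = Metric.infDist x M.carrier) :
    ∀ A : Set (Euc D), MeasurableSet A →
      ENNReal.ofReal (((τ - σ) / (τ + σ)) ^ d) * uniformOnManifold d M.carrier A ≤
          Measure.map P (unifOn (tube M.carrier σ)) A ∧
        Measure.map P (unifOn (tube M.carrier σ)) A ≤
          ENNReal.ofReal (((τ + σ) / (τ - σ)) ^ d) * uniformOnManifold d M.carrier A := by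
  have hu : UniqNear M.carrier τ := hreach ▸ uniqNear_reach _
  obtain ⟨κ, hκ0, hκt, hκ⟩ := exists_kappa d
  set K : ℝ≥0∞ := κ * volume (ball (0 : Euc (D - d)) σ) with hKdef
  have hK0 : K ≠ 0 := mul_ne_zero hκ0 (measure_ball_pos _ _ hσ0).ne'
  have hKt : K ≠ ⊤ := ENNReal.mul_ne_top hκt measure_ball_lt_top.ne
  set a : ℝ≥0∞ := ENNReal.ofReal ((1 - σ / τ) ^ d) with ha
  set b : ℝ≥0∞ := ENNReal.ofReal ((1 + σ / τ) ^ d) with hb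
  have hpos : 0 < 1 - σ / τ := by rw [sub_pos, div_lt_one hτ]; exact hστ
  have ha0 : a ≠ 0 := by rw [ha, Ne, ENNReal.ofReal_eq_zero, not_le]; positivity
  have hb0 : b ≠ 0 := by rw [hb, Ne, ENNReal.ofReal_eq_zero, not_le]; positivity
  have hat : a ≠ ⊤ := ENNReal.ofReal_ne_top
  have hbt : b ≠ ⊤ := ENNReal.ofReal_ne_top
  have htm : MeasurableSet (tube M.carrier σ) :=
    measurableSet_lt (Metric.continuous_infDist_pt _).measurable measurable_const
  set V : Measure (Euc D) := Measure.map P (volume.restrict (tube M.carrier σ)) with hV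
  have hVA : ∀ A, MeasurableSet A → V A = volume (P ⁻¹' A ∩ tube M.carrier σ) := by
    intro A hA
    rw [hV, Measure.map_apply hPmeas hA, Measure.restrict_apply (hPmeas hA)]
  have hMm : MeasurableSet M.carrier := M.isCompact.isClosed.measurableSet
  have hup : ∀ A, MeasurableSet A → A ⊆ M.carrier → V A ≤ b * K * μH[(d : ℝ)] A := by
    intro A hA hAM
    refine lim_aux 1 fun η hη => ?_
    have := loc_glob M.isCompact V ((ENNReal.ofReal η ^ 1 * (b * K)) • μH[(d : ℝ)]) ?_ A hA hAM
    · simpa [mul_assoc] using this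
    · intro y hy
      obtain ⟨c⟩ := exists_gchart hdD M hy
      obtain ⟨W, hW, hyW, h⟩ := c.local_bounds M.isCompact hu hσ0 hστ P hPmeas hP hκ hη
      refine ⟨W, hW, hyW, fun A hA hAW => ?_⟩
      rw [hVA A hA]
      refine (h A hA hAW).1.trans (le_of_eq ?_)
      simp only [Measure.smul_apply, smul_eq_mul, pow_one]
      ring
  have hlo : ∀ A, MeasurableSet A → A ⊆ M.carrier → a * K * μH[(d : ℝ)] A ≤ V A := by
    intro A hA hAM
    refine lim_aux (d + (D - d) + 1) fun η hη => ?_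
    have := loc_glob M.isCompact ((a * K) • μH[(d : ℝ)])
      ((ENNReal.ofReal η ^ (d + (D - d) + 1)) • V) ?_ A hA hAM
    · simpa using this
    · intro y hy
      obtain ⟨c⟩ := exists_gchart hdD M hy
      obtain ⟨W, hW, hyW, h⟩ := c.local_bounds M.isCompact hu hσ0 hστ P hPmeas hP hκ hη
      refine ⟨W, hW, hyW, fun A hA hAW => ?_⟩
      simp only [Measure.smul_apply, smul_eq_mul]
      rw [hVA A hA]
      exact (h A hA hAW).2
  have hVM : V M.carrier = volume (tube M.carrier σ) := by
    rw [hVA _ hMm]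
    congr 1
    exact Set.inter_eq_right.2 fun x hx => (hP x hx).1
  have hVi : ∀ A, MeasurableSet A → V A = V (A ∩ M.carrier) := by
    intro A hA
    rw [hVA _ hA, hVA _ (hA.inter hMm)]
    congr 1
    ext x
    constructor
    · rintro ⟨h1, h2⟩; exact ⟨⟨h1, (hP x h2).1⟩, h2⟩
    · rintro ⟨h1, h2⟩; exact ⟨h1.1, h2⟩
  have hmap : ∀ A, MeasurableSet A → Measure.map P (unifOn (tube M.carrier σ)) A =
      (V M.carrier)⁻¹ * V (A ∩ M.carrier) := by
    intro A hA
    rw [← hVi A hA, hVM, unifOn, Measure.map_smul, Measure.smul_apply, smul_eq_mul]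
  have hman : ∀ A, MeasurableSet A → uniformOnManifold d M.carrier A =
      (μH[(d : ℝ)] M.carrier)⁻¹ * μH[(d : ℝ)] (A ∩ M.carrier) := by
    intro A hA
    rw [uniformOnManifold, Measure.smul_apply, smul_eq_mul, Measure.restrict_apply hA]
  intro A hA
  have e1 : (τ - σ) / τ = 1 - σ / τ := by field_simp
  have e2 : (τ + σ) / τ = 1 + σ / τ := by field_simp
  rw [hmap A hA, hman A hA, ofReal_quot (x := τ - σ) (y := τ + σ) hτ (by linarith) (by linarith) d,
    ofReal_quot (x := τ + σ) (y := τ - σ) hτ (by linarith) (by linarith) d, e1, e2]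
  exact ⟨norm_lower hb0 hbt hK0 hKt (hup _ hMm subset_rfl)
      (hlo _ (hA.inter hMm) Set.inter_subset_right),
    norm_upper ha0 hat hK0 hKt (hlo _ hMm subset_rfl)
      (hup _ (hA.inter hMm) Set.inter_subset_right)⟩

/-- If `M` is a `C²` compact `d`-dimensional submanifold of `ℝ^D` with reach
`τ > 0` and `0 < σ < τ`, then the pushforward `Ũ` of the uniform distribution on the tube `M_σ`
under the nearest-point projection onto `M` is mutually absolutely continuous with the uniform
distribution `U_M` on `M`, with density bounded between `((τ−σ)/(τ+σ))^d` and
`((τ+σ)/(τ−σ))^d`. -/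
theorem pushforward_uniform_tube_density_bounds {D d : ℕ} (hdD : d ≤ D)
    (M : C2CompactSubmanifold D d) (τ σ : ℝ)
    (hτ : 0 < τ) (hreach : reach M.carrier = τ) (hσ0 : 0 < σ) (hστ : σ < τ)
    (P : Euc D → Euc D) (hPmeas : Measurable P)
    (hP : ∀ x ∈ tube M.carrier σ,
      P x ∈ M.carrier ∧ dist x (P x) = Metric.infDist x M.carrier) :
    (Measure.map P (unifOn (tube M.carrier σ)) ≪ uniformOnManifold d M.carrier) ∧
    (uniformOnManifold d M.carrier ≪ Measure.map P (unifOn (tube M.carrier σ))) ∧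
    ∀ A : Set (Euc D), MeasurableSet A →
      ENNReal.ofReal (((τ - σ) / (τ + σ)) ^ d) * uniformOnManifold d M.carrier A ≤
          Measure.map P (unifOn (tube M.carrier σ)) A ∧
        Measure.map P (unifOn (tube M.carrier σ)) A ≤
          ENNReal.ofReal (((τ + σ) / (τ - σ)) ^ d) * uniformOnManifold d M.carrier A := by
  have hb := main_bounds hdD M τ σ hτ hreach hσ0 hστ P hPmeas hP
  refine ⟨Measure.AbsolutelyContinuous.mk fun A hA h0 => ?_,
    Measure.AbsolutelyContinuous.mk fun A hA h0 => ?_, hb⟩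
  · have h := (hb A hA).2
    rw [h0, mul_zero] at h
    exact le_antisymm h bot_le
  · have h := (hb A hA).1
    rw [h0] at h
    rcases mul_eq_zero.1 (le_antisymm h bot_le) with h1 | h1
    · exfalso
      rw [ENNReal.ofReal_eq_zero, ← not_lt] at h1
      apply h1
      have : 0 < τ - σ := by linarith
      positivity
    · exact h1

end
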